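/- Suppose θ is inner and N-regular, and let (e,h,f) be a regular θ-adapted sl2-triple. Then for every i ∈ ℤ/mℤ, dim g_{i+1} − dim g_i = k_{−i−1} − k_i. -/

import Mathlib

open LieAlgebra Module

variable (k : Type*) [Field k] [IsAlgClosed k] [CharZero k]
variable (g : Type*) [LieRing g] [LieAlgebra k g] [FiniteDimensional k g]
  [LieAlgebra.IsSemisimple k g]

/-- The `ζ^i`-eigenspace of the automorphism `θ`, i.e. the graded piece `g_i`. -/
noncomputable def gradePiece {m : ℕ} (ζ : k) (θ : g ≃ₗ[k] g) (i : ZMod m) : Submodule k g :=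
  Module.End.eigenspace (θ : g →ₗ[k] g) (ζ ^ i.val)

/-- The centraliser `z(x) = {y : ⁅x, y⁆ = 0}` of `x`. -/
noncomputable def zc (x : g) : Submodule k g := LinearMap.ker (LieAlgebra.ad k g x)

/-- Truncated exponential of an endomorphism; it agrees with the exponential series for
nilpotent endomorphisms of a finite-dimensional space. -/
noncomputable def expEnd (N : Module.End k g) : Module.End k g :=
  ∑ i ∈ Finset.range (Module.finrank k g + 1), ((i.factorial : k))⁻¹ • N ^ i

/-- The group `Int g` of inner automorphisms: the subgroup of the automorphism group
generated by `exp (ad n)` for `n` with `ad n` nilpotent. -/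
noncomputable def IntG : Subgroup (g ≃ₗ[k] g) :=
  Subgroup.closure {τ | ∃ n : g, IsNilpotent (LieAlgebra.ad k g n) ∧
    (τ : g →ₗ[k] g) = expEnd k g (LieAlgebra.ad k g n)}

/-- A Cartan subspace of `g_1`: a commutative subspace consisting of semisimple elements,
maximal among subspaces of `g_1` with these two properties. -/
def IsCartanSubspace (m : ℕ) (ζ : k) (θ : g ≃ₗ[k] g) (c : Submodule k g) : Prop :=
  c ≤ gradePiece k g ζ θ (1 : ZMod m) ∧
  (∀ x ∈ c, ∀ y ∈ c, ⁅x, y⁆ = 0) ∧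
  (∀ x ∈ c, (LieAlgebra.ad k g x).IsSemisimple) ∧
  ∀ c' : Submodule k g, c' ≤ gradePiece k g ζ θ (1 : ZMod m) →
    (∀ x ∈ c', ∀ y ∈ c', ⁅x, y⁆ = 0) → (∀ x ∈ c', (LieAlgebra.ad k g x).IsSemisimple) →
    c ≤ c' → c = c'

/-- Polynomial functions on `g`: functions arising from the symmetric algebra of `g*`. -/
def IsPolyFun (F : g → k) : Prop :=
  ∃ p : MvPolynomial (Module.Dual k g) k, ∀ x, F x = MvPolynomial.eval (fun φ => φ x) p

/-- The number `k_i = Σ_{c ∈ ℤ, c ≡ i (mod m)} dim {v ∈ z(e) : ⁅h, v⁆ = 2c • v}`. -/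
noncomputable def kNum (m : ℕ) (e h : g) (i : ZMod m) : ℕ :=
  ∑ᶠ c : ℤ, if ((c : ZMod m) = i) then
    Module.finrank k ↥(zc k g e ⊓ Module.End.eigenspace (LieAlgebra.ad k g h) (2 * (c : k)))
  else 0

namespace DimPiece

/-- A linear endomorphism acting by the scalar `χ μ` on each generalised eigenspace of `φ`. -/
lemma exists_end_genEigen {K V : Type*} [Field K] [IsAlgClosed K] [AddCommGroup V] [Module K V]
    [FiniteDimensional K V] (φ : Module.End K V) (χ : K → K) :
    ∃ D : Module.End K V, ∀ μ, ∀ x ∈ φ.maxGenEigenspace μ, D x = χ μ • x := by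
  classical
  have hint : DirectSum.IsInternal (fun μ => φ.maxGenEigenspace μ) :=
    DirectSum.isInternal_submodule_of_iSupIndep_of_iSup_eq_top
      φ.independent_maxGenEigenspace φ.iSup_maxGenEigenspace_eq_top
  let E := LinearEquiv.ofBijective (DirectSum.coeLinearMap (fun μ => φ.maxGenEigenspace μ)) hint
  let F : DirectSum K (fun μ => φ.maxGenEigenspace μ) →ₗ[K] V :=
    DirectSum.toModule K K V (fun μ => χ μ • (φ.maxGenEigenspace μ).subtype)
  refine ⟨F ∘ₗ E.symm.toLinearMap, fun μ x hx => ?_⟩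
  have : E.symm x = DirectSum.lof K K (fun μ => φ.maxGenEigenspace μ) μ ⟨x, hx⟩ := by
    rw [LinearEquiv.symm_apply_eq]
    exact (DirectSum.coeLinearMap_lof (fun μ => φ.maxGenEigenspace μ) μ ⟨x, hx⟩).symm
  simp [this, F]

lemma genEigen_induction {K V : Type*} [Field K] [IsAlgClosed K] [AddCommGroup V] [Module K V]
    [FiniteDimensional K V] (φ : Module.End K V) {P : V → Prop}
    (h1 : ∀ μ, ∀ x ∈ φ.maxGenEigenspace μ, P x) (h0 : P 0)
    (ha : ∀ x y, P x → P y → P (x + y)) (x : V) : P x := by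
  have hx : x ∈ ⨆ μ, φ.maxGenEigenspace μ := by
    rw [φ.iSup_maxGenEigenspace_eq_top]; trivial
  exact Submodule.iSup_induction (motive := P) _ hx h1 h0 ha

lemma mem_genEigen_of_sub {K V : Type*} [Field K] [AddCommGroup V] [Module K V]
    (φ : Module.End K V) (c : K) (z : V)
    (h : (φ - c • 1) z ∈ φ.maxGenEigenspace c) : z ∈ φ.maxGenEigenspace c := by
  rw [Module.End.mem_maxGenEigenspace] at h ⊢
  obtain ⟨n, hn⟩ := h
  exact ⟨n + 1, by rw [pow_succ, Module.End.mul_apply, hn]⟩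

lemma eq_zero_of_genEigen {K V : Type*} [Field K] [AddCommGroup V] [Module K V]
    (φ : Module.End K V) (c : K) (hc : ¬ φ.HasEigenvalue c) (z : V)
    (h : z ∈ φ.maxGenEigenspace c) : z = 0 := by
  rw [Module.End.mem_maxGenEigenspace] at h
  obtain ⟨n, hn⟩ := h
  induction n with
  | zero => simpa using hn
  | succ n ih =>
    apply ih
    by_contra hne
    apply hc
    rw [pow_succ'] at hn
    refine Module.End.hasEigenvalue_of_hasEigenvector (x := ((φ - c • 1) ^ n) z) ⟨?_, hne⟩
    rw [Module.End.mem_eigenspace_iff]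
    simpa [sub_eq_zero] using hn

lemma lie_mem_genEigen {K L : Type*} [Field K] [LieRing L] [LieAlgebra K L]
    (σ : Module.End K L) (hσ : ∀ x y, σ ⁅x, y⁆ = ⁅σ x, σ y⁆) (a b : K) (x y : L)
    (hx : x ∈ σ.maxGenEigenspace a) (hy : y ∈ σ.maxGenEigenspace b) :
    ⁅x, y⁆ ∈ σ.maxGenEigenspace (a * b) := by
  rw [Module.End.mem_maxGenEigenspace] at hx hy
  obtain ⟨m, hm⟩ := hx
  obtain ⟨n, hn⟩ := hy
  induction hN : m + n generalizing m n x y with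
  | zero =>
    obtain rfl : m = 0 := by omega
    have : x = 0 := by simpa using hm
    simp [this]
  | succ N ih =>
    rcases m with _ | m
    · have : x = 0 := by simpa using hm
      simp [this]
    rcases n with _ | n
    · have : y = 0 := by simpa using hn
      simp [this]
    apply mem_genEigen_of_sub
    have key : (σ - (a * b) • 1) ⁅x, y⁆ = ⁅(σ - a • 1) x, σ y⁆ + a • ⁅x, (σ - b • 1) y⁆ := by
      simp [hσ, sub_lie, lie_sub, smul_sub, mul_smul]
    rw [key]
    refine add_mem ?_ (Submodule.smul_mem _ _ ?_)
    · refine ih _ _ m ?_ (n + 1) ?_ (by omega)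
      · rw [← Module.End.mul_apply, ← pow_succ, hm]
      · have hc : Commute ((σ - b • 1) ^ (n + 1)) σ :=
          Commute.pow_left (by simp [Commute, SemiconjBy, sub_mul, mul_sub]) _
        rw [← Module.End.mul_apply, hc.eq, Module.End.mul_apply, hn, map_zero]
    · refine ih _ _ (m + 1) hm n ?_ (by omega)
      rw [← Module.End.mul_apply, ← pow_succ, hn]

/-- An automorphism whose eigenvalues can be linearised has generalised fixed space of dimension
at least the rank. -/
lemma rank_le_finrank_genEigen {K L : Type*} [Field K] [IsAlgClosed K] [CharZero K]
    [LieRing L] [LieAlgebra K L] [FiniteDimensional K L] [LieAlgebra.IsKilling K L]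
    (σ : Module.End K L) (hσ : ∀ x y, σ ⁅x, y⁆ = ⁅σ x, σ y⁆) (χ : K → K)
    (hχ : ∀ a b, σ.HasEigenvalue a → σ.HasEigenvalue b → χ (a * b) = χ a + χ b)
    (hχ1 : ∀ a, σ.HasEigenvalue a → χ a = 0 → a = 1) :
    LieAlgebra.rank K L ≤ finrank K (σ.maxGenEigenspace 1) := by
  obtain ⟨D, hD⟩ := exists_end_genEigen σ χ
  have hder : ∀ x y, D ⁅x, y⁆ = ⁅x, D y⁆ - ⁅y, D x⁆ := by
    intro x y
    induction x using genEigen_induction σ with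
    | h0 => simp
    | ha x x' h h' => simp [h, h']; abel
    | h1 a x hx =>
      induction y using genEigen_induction σ with
      | h0 => simp
      | ha x x' h h' => simp [h, h']; abel
      | h1 b y hy =>
        by_cases ha : σ.HasEigenvalue a
        swap
        · simp [eq_zero_of_genEigen σ a ha x hx]
        by_cases hb : σ.HasEigenvalue b
        swap
        · simp [eq_zero_of_genEigen σ b hb y hy]
        rw [hD _ _ hx, hD _ _ hy, hD _ _ (lie_mem_genEigen σ hσ a b x y hx hy), hχ a b ha hb,
          lie_smul, lie_smul, ← lie_skew x y]
        module
  let DD : LieDerivation K L L := { D with leibniz' := hder }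
  obtain ⟨X, hX⟩ := LieDerivation.IsKilling.exists_eq_ad DD
  refine (LieAlgebra.rank_le_finrank_engel K X).trans (Submodule.finrank_mono ?_)
  have hXD : LieAlgebra.ad K L X = D := by
    ext y
    have := congrArg (fun d : LieDerivation K L L => d y) hX
    simpa [DD] using this
  obtain ⟨D', hD'⟩ := exists_end_genEigen σ (fun μ => (χ μ)⁻¹)
  have hcomm : Commute D' D := by
    ext x
    induction x using genEigen_induction σ with
    | h0 => simp
    | ha x x' h h' => simp only [map_add, h, h']
    | h1 a x hx => simp [hD _ _ hx, hD' _ _ hx, smul_smul, mul_comm]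
  have hid : ∀ x, (D' * D) ((D' * D) x) = (D' * D) x := by
    intro x
    induction x using genEigen_induction σ with
    | h0 => simp
    | ha x x' h h' => simp only [map_add, h, h']
    | h1 a x hx =>
      simp only [Module.End.mul_apply, hD _ _ hx, hD' _ _ hx, map_smul, smul_smul]
      congr 1
      by_cases h : χ a = 0 <;> field_simp [h]
  have hsub : ∀ x, x - (D' * D) x ∈ σ.maxGenEigenspace 1 := by
    intro x
    induction x using genEigen_induction σ with
    | h0 => simp
    | ha x x' h h' =>
      rw [map_add, add_sub_add_comm]; exact add_mem h h'
    | h1 a x hx =>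
      by_cases ha : σ.HasEigenvalue a
      swap
      · simp [eq_zero_of_genEigen σ a ha x hx]
      simp only [Module.End.mul_apply, hD _ _ hx, hD' _ _ hx, map_smul, smul_smul]
      by_cases h : χ a = 0
      · have := hχ1 a ha h
        subst this
        simpa [h] using hx
      · simp [h]
  intro x hx
  have hx' : x ∈ (LieAlgebra.ad K L X).maxGenEigenspace 0 := hx
  rw [hXD, Module.End.mem_maxGenEigenspace] at hx'
  obtain ⟨n, hn⟩ := hx'
  have hn' : (D ^ (n + 1)) x = 0 := by
    rw [pow_succ', Module.End.mul_apply]; simpa using congrArg D hn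
  have h3 : ∀ n : ℕ, ((D' * D) ^ (n + 1)) x = (D' * D) x := by
    intro n
    induction n with
    | zero => simp
    | succ n ih => rw [pow_succ', Module.End.mul_apply, ih, hid]
  have h4 : (D' * D) x = 0 := by
    rw [← h3 n, hcomm.mul_pow, Module.End.mul_apply, hn', map_zero]
  have := hsub x
  rwa [h4, sub_zero] at this

end DimPiece

namespace DimPiece

open scoped TensorProduct in
lemma exists_chi_of_torsionFree {U K : Type*} [CommGroup U] [Field K] [CharZero K]
    (hU : ∀ (u : U) (n : ℕ), n ≠ 0 → u ^ n = 1 → u = 1) (S : Set U) (hS : S.Finite) :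
    ∃ f : U → K, (∀ a b, f (a * b) = f a + f b) ∧ ∀ a ∈ S, f a = 0 → a = 1 := by
  have hT : Module.IsTorsionFree ℤ (Additive U) := by
    have : IsAddTorsionFree (Additive U) := by
      rw [isAddTorsionFree_iff_not_isOfFinAddOrder]
      intro a ha hfin
      obtain ⟨n, hn, h⟩ := isOfFinAddOrder_iff_nsmul_eq_zero |>.1 hfin
      exact ha (hU (Additive.toMul a) n hn.ne' h)
    infer_instance
  have hF : Module.Flat ℤ (Additive U) := by
    infer_instance
  let j : Additive U →ₗ[ℤ] TensorProduct ℤ ℚ (Additive U) := TensorProduct.mk ℤ ℚ (Additive U) 1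
  have hj : Function.Injective j := by
    have h1 := Module.Flat.rTensor_preserves_injective_linearMap (M := Additive U)
      (Algebra.linearMap ℤ ℚ) (by intro a b; simp)
    rw [injective_iff_map_eq_zero]
    intro x hx
    have h2 : (Algebra.linearMap ℤ ℚ).rTensor (Additive U) (1 ⊗ₜ x) = 0 := by
      have e : (Algebra.linearMap ℤ ℚ) 1 = 1 := by simp
      rw [LinearMap.rTensor_tmul, e]
      exact hx
    have h3 := h1 (h2.trans (map_zero _).symm)
    simpa using congrArg (TensorProduct.lid ℤ (Additive U)) h3
  have : Finite {a : U // a ∈ S ∧ a ≠ 1} := by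
    exact (hS.subset (fun a h => h.1) : {a : U | a ∈ S ∧ a ≠ 1}.Finite).to_subtype
  obtain ⟨φ, hφ⟩ := Module.exists_dual_forall_apply_ne_zero (K := ℚ)
    (fun a : {a : U // a ∈ S ∧ a ≠ 1} => j (Additive.ofMul a.1)) (by
      rintro ⟨a, ha, ha1⟩ h
      exact ha1 (hj (h.trans (map_zero j).symm)))
  refine ⟨fun a => ((φ (j (Additive.ofMul a)) : ℚ) : K), ?_, ?_⟩
  · intro a b
    simp [ofMul_mul]
  · intro a ha h
    by_contra ha1
    exact hφ ⟨a, ha, ha1⟩ (Rat.cast_eq_zero.1 h)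

open Polynomial in
lemma exists_chi {k A K : Type*} [Field k] [CharZero k] [CommRing A] [Algebra k A] [Field K]
    [CharZero K] [Algebra A K] (hinj : Function.Injective (algebraMap A K)) (ev : A →ₐ[k] k)
    (p : A[X]) (hp : p.Monic) (n : ℕ) (hpn : p.map (ev : A →+* k) = (X - 1) ^ n) :
    ∃ χ : K → K, (∀ a b, aeval a p = 0 → aeval b p = 0 → χ (a * b) = χ a + χ b) ∧
      ∀ a, aeval a p = 0 → χ a = 0 → a = 1 := by
  classical
  let ι := (algebraMap A K).rangeRestrict
  have hιs : Function.Surjective ι := RingHom.rangeRestrict_surjective _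
  let I : Ideal (algebraMap A K).range := (RingHom.ker (ev : A →+* k)).map ι
  have hker : ∀ x, x ∈ I ↔ ∃ a, ev a = 0 ∧ ι a = x := by
    intro x
    rw [Ideal.mem_map_iff_of_surjective ι hιs]
    simp [RingHom.mem_ker]
  have hI : I ≠ ⊤ := by
    rw [Ne, Ideal.eq_top_iff_one, hker]
    rintro ⟨a, ha, h⟩
    have : a = 1 := hinj (by simpa [ι] using congrArg Subtype.val h)
    simp [this] at ha
  obtain ⟨B, hB1, hB2⟩ := Ideal.image_subset_nonunits_valuationSubring I hI
  let v := B.valuation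
  have hv1 : ∀ a : A, v (algebraMap A K a) ≤ 1 := fun a =>
    (B.valuation_le_one_iff _).2 (hB1 ⟨a, rfl⟩)
  have hv2 : ∀ a : A, ev a = 0 → v (algebraMap A K a) < 1 := by
    intro a ha
    have : algebraMap A K a ∈ B.nonunits := hB2 ⟨ι a, (hker _).2 ⟨a, ha, rfl⟩, rfl⟩
    exact (B.mem_nonunits_iff).1 this
  have hvn : ∀ n : ℕ, n ≠ 0 → v (n : K) = 1 := by
    intro n hn
    have h1 : v (n : K) ≤ 1 := by simpa using hv1 (n : A)
    have h2 : v ((n : K)⁻¹) ≤ 1 := by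
      have : algebraMap A K (algebraMap k A ((n : k)⁻¹)) = (n : K)⁻¹ := by
        have hn' : (n : K) ≠ 0 := by exact_mod_cast hn
        have hn'' : (n : k) ≠ 0 := by exact_mod_cast hn
        refine eq_inv_of_mul_eq_one_left ?_
        have : (n : K) = algebraMap A K (algebraMap k A (n : k)) := by simp
        rw [this, ← map_mul, ← map_mul, inv_mul_cancel₀ hn'', map_one, map_one]
      rw [← this]; exact hv1 _
    rw [map_inv₀] at h2
    refine le_antisymm h1 ?_
    have hne : v (n : K) ≠ 0 := by
      rw [Valuation.ne_zero_iff]; exact_mod_cast hn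
    exact (inv_le_one₀ (zero_lt_iff.2 hne)).1 h2
  have hroot : ∀ a : K, aeval a p = 0 → v (a - 1) < 1 := by
    intro a ha
    have ha1 : v a ≤ 1 := by
      let γ : A →+* B := (algebraMap A K).codRestrict B.toSubring (fun x => hB1 ⟨x, rfl⟩)
      have hint : IsIntegral B a := by
        refine ⟨p.map γ, hp.map γ, ?_⟩
        rw [eval₂_map]
        exact ha
      obtain ⟨y, hy⟩ := IsIntegrallyClosed.isIntegral_iff.1 hint
      rw [← hy]
      exact (B.valuation_le_one_iff _).2 y.2
    have h1 : (a - 1) ^ n = aeval a ((X - 1) ^ n - p : A[X]) := by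
      rw [map_sub, ha]; simp
    have h2 : v (aeval a ((X - 1) ^ n - p : A[X])) < 1 := by
      rw [aeval_eq_sum_range]
      refine v.map_sum_lt one_ne_zero fun i _ => ?_
      rw [Algebra.smul_def, map_mul, map_pow]
      refine mul_lt_one_of_lt_of_le (hv2 _ ?_) (pow_le_one' ha1 i)
      have h3 : ((X - 1) ^ n - p : A[X]).map (ev : A →+* k) = 0 := by
        rw [Polynomial.map_sub, hpn]; simp
      have := congrArg (fun q => q.coeff i) h3
      simp only [Polynomial.coeff_map, Polynomial.coeff_zero] at this
      exact this
    rw [← h1, map_pow] at h2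
    by_contra h3
    exact absurd h2 (not_lt.2 (one_le_pow_of_one_le' (not_lt.1 h3) n))
  have hU : ∀ (u : B.principalUnitGroup) (n : ℕ), n ≠ 0 → u ^ n = 1 → u = 1 := by
    rintro ⟨u, hu⟩ n hn h
    rw [B.mem_principalUnitGroup_iff] at hu
    by_contra hne
    have hne' : (u : K) ≠ 1 := by
      intro h; apply hne; ext; simpa using h
    have hun : (u : K) ^ n = 1 := by
      have := congrArg (fun x : B.principalUnitGroup => ((x : Kˣ) : K)) h
      simpa using this
    have hs : ∑ i ∈ Finset.range n, (u : K) ^ i = 0 := by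
      have := geom_sum_mul (u : K) n
      rw [hun, sub_self] at this
      exact (mul_eq_zero.1 this).resolve_right (sub_ne_zero.2 hne')
    have hu1 : v (u : K) ≤ 1 := by
      have : (u : K) = (u - 1) + 1 := by ring
      rw [this]
      exact v.map_add_le hu.le (by simp)
    have hpow : ∀ i : ℕ, v ((u : K) ^ i - 1) < 1 := by
      intro i
      rw [← mul_geom_sum, map_mul]
      refine mul_lt_one_of_lt_of_le hu ?_
      refine v.map_sum_le fun i _ => ?_
      rw [map_pow]; exact pow_le_one' hu1 i
    have h3 : v (∑ i ∈ Finset.range n, ((u : K) ^ i - 1)) < 1 :=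
      v.map_sum_lt one_ne_zero fun i _ => hpow i
    rw [Finset.sum_sub_distrib, hs] at h3
    simp [hvn n hn] at h3
  let R : Set K := {a | aeval a p = 0}
  have hR : R.Finite := by
    have := (p.map (algebraMap A K)).roots.toFinset.finite_toSet
    refine this.subset fun a ha => ?_
    have h0 : p.map (algebraMap A K) ≠ 0 := (hp.map _).ne_zero
    simp only [Finset.mem_coe, Multiset.mem_toFinset]
    rw [mem_roots h0, IsRoot.def, eval_map_algebraMap]; exact ha
  have hne : ∀ a ∈ R, a ≠ 0 := by
    rintro a ha rfl
    simpa using hroot 0 ha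
  obtain ⟨f, hf1, hf2⟩ := exists_chi_of_torsionFree (K := K) hU
    {u | ((u : Kˣ) : K) ∈ R} (hR.preimage (by
      intro a _ b _ h
      exact Subtype.ext (Units.ext h)))
  let χ : K → K := fun x =>
    if h : ∃ u : B.principalUnitGroup, ((u : Kˣ) : K) = x then f h.choose else 0
  have hχ : ∀ u : B.principalUnitGroup, χ ((u : Kˣ) : K) = f u := by
    intro u
    have h : ∃ w : B.principalUnitGroup, ((w : Kˣ) : K) = ((u : Kˣ) : K) := ⟨u, rfl⟩
    simp only [χ, dif_pos h]
    congr 1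
    exact Subtype.ext (Units.ext h.choose_spec)
  have hlift : ∀ a ∈ R, ∃ u : B.principalUnitGroup, ((u : Kˣ) : K) = a := by
    intro a ha
    exact ⟨⟨Units.mk0 a (hne a ha), (B.mem_principalUnitGroup_iff _).2 (hroot a ha)⟩, rfl⟩
  refine ⟨χ, ?_, ?_⟩
  · intro a b ha hb
    obtain ⟨u, rfl⟩ := hlift a ha
    obtain ⟨w, rfl⟩ := hlift b hb
    have := hχ (u * w)
    rw [Subgroup.coe_mul, Units.val_mul] at this
    rw [this, hχ, hχ, hf1]
  · intro a ha h
    obtain ⟨u, rfl⟩ := hlift a ha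
    rw [hχ] at h
    rw [hf2 u ha h]; simp

end DimPiece

namespace DimPiece

open scoped TensorProduct

lemma rank_le_rank_baseChange (R A L : Type*) [CommRing R] [Nontrivial R] [CommRing A] [Nontrivial A]
    [Algebra R A] [LieRing L] [LieAlgebra R L] [Module.Finite R L] [Module.Free R L] :
    LieAlgebra.rank R L ≤ LieAlgebra.rank A (A ⊗[R] L) := by
  classical
  let b := Module.Free.chooseBasis R L
  rw [LieAlgebra.rank_eq_natTrailingDegree R L b,
    LieAlgebra.rank_eq_natTrailingDegree A (A ⊗[R] L) (Algebra.TensorProduct.basis A b)]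
  have h1 : (LieAlgebra.ad A (A ⊗[R] L) : (A ⊗[R] L) →ₗ[A] End A (A ⊗[R] L)) =
      LinearMap.tensorProduct _ _ _ _ ∘ₗ
        (LieAlgebra.ad R L : L →ₗ[R] End R L).baseChange A := by
    ext x y
    simp only [TensorProduct.AlgebraTensorModule.curry_apply,
      TensorProduct.curry_apply, LinearMap.coe_restrictScalars, LinearMap.coe_comp,
      Function.comp_apply, LinearMap.baseChange_tmul]
    simp [LinearMap.tensorProduct]
  have h2 := LinearMap.polyCharpoly_baseChange (LieAlgebra.ad R L : L →ₗ[R] End R L) b A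
  rw [← h1] at h2
  have h3 : ((LieAlgebra.ad A (A ⊗[R] L) : (A ⊗[R] L) →ₗ[A] End A (A ⊗[R] L)).polyCharpoly (Algebra.TensorProduct.basis A b)) ≠ 0 :=
    (LinearMap.polyCharpoly_monic _ _).ne_zero
  refine Polynomial.le_natTrailingDegree h3 fun m hm => ?_
  rw [h2, Polynomial.coeff_map, Polynomial.coeff_eq_zero_of_lt_natTrailingDegree hm, map_zero]

lemma killing_det_baseChange (R A L : Type*) [CommRing R] [CommRing A]
    [Algebra R A] [LieRing L] [LieAlgebra R L] [Module.Finite R L] [Module.Free R L]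
    {ι : Type*} [Fintype ι] [DecidableEq ι] (b : Basis ι R L) :
    (LinearMap.BilinForm.toMatrix (Algebra.TensorProduct.basis A b) (killingForm A (A ⊗[R] L))).det =
      algebraMap R A (LinearMap.BilinForm.toMatrix b (killingForm R L)).det := by
  rw [RingHom.map_det]
  congr 1
  ext i j
  have := LieModule.traceForm_baseChange R L L A
  rw [killingForm, this]
  simp [LinearMap.BilinForm.toMatrix_apply, Algebra.algebraMap_eq_smul_one]

lemma isKilling_of_det (K L : Type*) [Field K] [LieRing L] [LieAlgebra K L]
    {ι : Type*} [Fintype ι] [DecidableEq ι] (b : Basis ι K L)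
    (h : (LinearMap.BilinForm.toMatrix b (killingForm K L)).det ≠ 0) : LieAlgebra.IsKilling K L := by
  have h1 := (LinearMap.BilinForm.nondegenerate_iff_det_ne_zero b).2 h
  refine ⟨?_⟩
  rw [LieSubmodule.eq_bot_iff]
  intro x hx
  rw [LieIdeal.mem_killingCompl] at hx
  exact h1.2 x fun y => hx y trivial

lemma det_of_isKilling (K L : Type*) [Field K] [LieRing L] [LieAlgebra K L] [LieAlgebra.IsKilling K L]
    {ι : Type*} [Fintype ι] [DecidableEq ι] (b : Basis ι K L) :
    (LinearMap.BilinForm.toMatrix b (killingForm K L)).det ≠ 0 := 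
  (LinearMap.BilinForm.nondegenerate_iff_det_ne_zero b).1 (IsKilling.killingForm_nondegenerate K L)

end DimPiece

namespace DimPiece

open scoped TensorProduct

/-- Specialisation of `A ⊗ V` along a `k`-algebra morphism `ev : A → k`. -/
noncomputable def spec {k A V : Type*} [Field k] [CommRing A] [Algebra k A] [AddCommGroup V]
    [Module k V] (ev : A →ₐ[k] k) : A ⊗[k] V →ₗ[k] V :=
  TensorProduct.lid k V ∘ₗ ev.toLinearMap.rTensor V

@[simp] lemma spec_tmul {k A V : Type*} [Field k] [CommRing A] [Algebra k A] [AddCommGroup V]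
    [Module k V] (ev : A →ₐ[k] k) (a : A) (x : V) : spec ev (a ⊗ₜ[k] x) = ev a • x := by
  simp [spec]

lemma spec_smul {k A V : Type*} [Field k] [CommRing A] [Algebra k A] [AddCommGroup V]
    [Module k V] (ev : A →ₐ[k] k) (a : A) (x : A ⊗[k] V) : spec ev (a • x) = ev a • spec ev x := by
  induction x with
  | zero => simp
  | tmul b x => simp [TensorProduct.smul_tmul', mul_smul]
  | add x y hx hy => simp [smul_add, hx, hy]

lemma spec_lie {k A g : Type*} [Field k] [CommRing A] [Algebra k A] [LieRing g] [LieAlgebra k g]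
    (ev : A →ₐ[k] k) (x y : A ⊗[k] g) : spec ev ⁅x, y⁆ = ⁅spec ev x, spec ev y⁆ := by
  induction x with
  | zero => simp
  | add x x' hx hx' => simp [hx, hx']
  | tmul a x =>
    induction y with
    | zero => simp
    | add x x' hx hx' => simp [hx, hx']
    | tmul b y => simp [mul_smul]; rw [smul_comm]

lemma charpoly_spec {k A V : Type*} [Field k] [CommRing A] [Algebra k A] [AddCommGroup V]
    [Module k V] [FiniteDimensional k V] (ev : A →ₐ[k] k) (Φ : End A (A ⊗[k] V)) (τ : End k V)
    (h : ∀ x, spec ev (Φ x) = τ (spec ev x)) :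
    Φ.charpoly.map (ev : A →+* k) = τ.charpoly := by
  classical
  let b := Module.Free.chooseBasis k V
  rw [← LinearMap.charpoly_toMatrix Φ (Algebra.TensorProduct.basis A b),
    ← LinearMap.charpoly_toMatrix τ b, ← Matrix.charpoly_map]
  congr 1
  ext i j
  rw [Matrix.map_apply, LinearMap.toMatrix_apply, LinearMap.toMatrix_apply]
  have key : ∀ x : A ⊗[k] V, ev ((Algebra.TensorProduct.basis A b).repr x i) =
      b.repr (spec ev x) i := by
    intro x
    induction x with
    | zero => simp
    | add x y hx hy => simp [hx, hy]
    | tmul a x => simp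
  have := key (Φ (Algebra.TensorProduct.basis A b j))
  rw [h] at this
  simpa using this

lemma baseChange_lie {A K L : Type*} [CommRing A] [CommRing K] [Algebra A K] [LieRing L]
    [LieAlgebra A L] (Φ : End A L) (hΦ : ∀ x y, Φ ⁅x, y⁆ = ⁅Φ x, Φ y⁆) (x y : K ⊗[A] L) :
    Φ.baseChange K ⁅x, y⁆ = ⁅Φ.baseChange K x, Φ.baseChange K y⁆ := by
  induction x with
  | zero => simp
  | add x x' hx hx' => simp [hx, hx']
  | tmul a x =>
    induction y with
    | zero => simp
    | add x x' hx hx' => simp only [lie_add, map_add, hx, hx']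
    | tmul b y => simp [hΦ]

lemma rank_le_of_path {k A g : Type*} [Field k] [IsAlgClosed k] [CharZero k] [CommRing A]
    [IsDomain A] [Algebra k A]
    [LieRing g] [LieAlgebra k g] [FiniteDimensional k g] [LieAlgebra.IsKilling k g]
    (ev0 ev1 : A →ₐ[k] k) (Φ : End A (A ⊗[k] g)) (hΦ : ∀ x y, Φ ⁅x, y⁆ = ⁅Φ x, Φ y⁆)
    (h0 : ∀ x, spec ev0 (Φ x) = spec ev0 x) (τ : End k g)
    (h1 : ∀ x, spec ev1 (Φ x) = τ (spec ev1 x)) :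
    LieAlgebra.rank k g ≤ finrank k (τ.maxGenEigenspace 1) := by
  classical
  let K := AlgebraicClosure (FractionRing A)
  have hinj : Function.Injective (algebraMap A K) := by
    rw [IsScalarTower.algebraMap_eq A (FractionRing A) K]
    exact (algebraMap (FractionRing A) K).injective.comp (IsFractionRing.injective A _)
  have : CharZero A := charZero_of_injective_algebraMap (algebraMap k A).injective
  have : CharZero K := charZero_of_injective_algebraMap hinj
  let b := Module.Free.chooseBasis k g
  have : LieAlgebra.IsKilling K (K ⊗[A] (A ⊗[k] g)) := by
    apply isKilling_of_det K _ (Algebra.TensorProduct.basis K (Algebra.TensorProduct.basis A b))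
    rw [killing_det_baseChange, killing_det_baseChange]
    rw [Ne, map_eq_zero_iff _ hinj, map_eq_zero_iff _ (algebraMap k A).injective]
    exact det_of_isKilling k g b
  have hc0 : Φ.charpoly.map (ev0 : A →+* k) = (Polynomial.X - 1) ^ finrank k g := by
    rw [charpoly_spec ev0 Φ 1 h0]
    exact LinearMap.charpoly_one 
  obtain ⟨χ, hχ, hχ1⟩ := exists_chi (K := K) hinj ev0 Φ.charpoly Φ.charpoly_monic _ hc0
  have hr : ∀ a : K, Module.End.HasEigenvalue (Φ.baseChange K) a → Polynomial.aeval a Φ.charpoly = 0 := by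
    intro a ha
    rw [Module.End.hasEigenvalue_iff_isRoot_charpoly, LinearMap.charpoly_baseChange,
      Polynomial.IsRoot.def, Polynomial.eval_map_algebraMap] at ha
    exact ha
  have hle := rank_le_finrank_genEigen (Φ.baseChange K) (baseChange_lie Φ hΦ) χ
    (fun a b ha hb => hχ a b (hr a ha) (hr b hb)) (fun a ha => hχ1 a (hr a ha))
  have hle2 := (rank_le_rank_baseChange k A g).trans
    ((rank_le_rank_baseChange A K (A ⊗[k] g)).trans hle)
  rw [LinearMap.finrank_maxGenEigenspace_eq, LinearMap.charpoly_baseChange,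
    Polynomial.le_rootMultiplicity_iff (Φ.charpoly_monic.map _).ne_zero] at hle2
  rw [LinearMap.finrank_maxGenEigenspace_eq,
    Polynomial.le_rootMultiplicity_iff τ.charpoly_monic.ne_zero, ← charpoly_spec ev1 Φ τ h1]
  have hd : (Polynomial.X - Polynomial.C (1 : A)) ^ (LieAlgebra.rank k g) ∣ Φ.charpoly := by
    rw [← Polynomial.map_dvd_map _ hinj ((Polynomial.monic_X_sub_C _).pow _)]
    simpa using hle2
  have := Polynomial.map_dvd (ev1 : A →+* k) hd
  simpa using this

end DimPiece

namespace DimPiece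

open scoped TensorProduct

/-- `τ` can be joined to the identity by a polynomial path of Lie algebra endomorphisms. -/
def HasPath {k A g : Type*} [Field k] [CommRing A] [Algebra k A] [LieRing g] [LieAlgebra k g]
    (ev0 ev1 : A →ₐ[k] k) (τ : End k g) : Prop :=
  ∃ Φ : End A (A ⊗[k] g), (∀ x y, Φ ⁅x, y⁆ = ⁅Φ x, Φ y⁆) ∧
    (∀ x, spec ev0 (Φ x) = spec ev0 x) ∧
    (∀ x, spec ev1 (Φ x) = τ (spec ev1 x))

lemma HasPath.rank_le {k A g : Type*} [Field k] [CharZero k] [CommRing A] [Algebra k A] [IsDomain A] {ev0 ev1 : A →ₐ[k] k} [IsAlgClosed k] [LieRing g]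
    [LieAlgebra k g] [FiniteDimensional k g] [LieAlgebra.IsKilling k g] {τ : End k g}
    (h : HasPath ev0 ev1 τ) :
    LieAlgebra.rank k g ≤ finrank k (τ.maxGenEigenspace 1) := by
  obtain ⟨Φ, h1, h2, h3⟩ := h
  exact rank_le_of_path ev0 ev1 Φ h1 h2 τ h3

lemma HasPath.one {k A g : Type*} [Field k] [CharZero k] [CommRing A] [Algebra k A] {ev0 ev1 : A →ₐ[k] k} [LieRing g] [LieAlgebra k g] :
    HasPath ev0 ev1 (1 : End k g) := ⟨1, by simp, by simp, by simp⟩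

lemma HasPath.mul {k A g : Type*} [Field k] [CharZero k] [CommRing A] [Algebra k A] {ev0 ev1 : A →ₐ[k] k} [LieRing g] [LieAlgebra k g]
    {τ τ' : End k g} (h : HasPath ev0 ev1 τ) (h' : HasPath ev0 ev1 τ') : HasPath ev0 ev1 (τ * τ') := by
  obtain ⟨Φ, h1, h2, h3⟩ := h
  obtain ⟨Φ', h1', h2', h3'⟩ := h'
  exact ⟨Φ * Φ', by simp [h1, h1'], by simp [h2, h2'], by simp [h3, h3']⟩

lemma ev_zpow {k A : Type*} [Field k] [CommRing A] [Algebra k A] (ev : A →ₐ[k] k) (t : Aˣ)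
    (n : ℤ) : ev ((t ^ n : Aˣ) : A) = (ev t) ^ n := by
  have : ev ((t ^ n : Aˣ) : A) = ((Units.map (ev : A →* k) (t ^ n) : kˣ) : k) := rfl
  rw [this, map_zpow, Units.val_zpow_eq_zpow_val]
  rfl

lemma HasPath.grading {k A g : Type*} [Field k] [CharZero k] [CommRing A] [Algebra k A] {ev0 ev1 : A →ₐ[k] k} [LieRing g] [LieAlgebra k g]
    (t : Aˣ) (ht0 : ev0 t = 1) (ht1 : ev1 t = 2) (W : ℤ → Submodule k g) (hind : iSupIndep W) (htop : iSup W = ⊤)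
    (hlie : ∀ a b, ∀ x ∈ W a, ∀ y ∈ W b, ⁅x, y⁆ ∈ W (a + b)) (τ : End k g)
    (hτ : ∀ n, ∀ x ∈ W n, τ x = (2 : k) ^ n • x) : HasPath ev0 ev1 τ := by
  classical
  have hint : DirectSum.IsInternal W :=
    DirectSum.isInternal_submodule_of_iSupIndep_of_iSup_eq_top hind htop
  let E := LinearEquiv.ofBijective (DirectSum.coeLinearMap W) hint
  let F : DirectSum ℤ (fun n => W n) →ₗ[k] A ⊗[k] g :=
    DirectSum.toModule k ℤ _ (fun n => (TensorProduct.mk k A g ((t ^ n : Aˣ) : A)) ∘ₗ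
      (W n).subtype)
  let L : g →ₗ[k] A ⊗[k] g := F ∘ₗ E.symm.toLinearMap
  have hL : ∀ n, ∀ x ∈ W n, L x = ((t ^ n : Aˣ) : A) ⊗ₜ x := by
    intro n x hx
    have : E.symm x = DirectSum.lof k ℤ (fun n => W n) n ⟨x, hx⟩ := by
      rw [LinearEquiv.symm_apply_eq]
      exact (DirectSum.coeLinearMap_lof W n ⟨x, hx⟩).symm
    simp [L, this, F]
  have hLie : ∀ x y : g, L ⁅x, y⁆ = ⁅L x, L y⁆ := by
    intro x y
    have hx : x ∈ iSup W := by rw [htop]; trivial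
    have hy : y ∈ iSup W := by rw [htop]; trivial
    induction hx using Submodule.iSup_induction' with
    | zero => simp
    | add x x' _ _ h h' => simp [h, h']
    | mem a x hx =>
      induction hy using Submodule.iSup_induction' with
      | zero => simp
      | add x x' _ _ h h' => simp [h, h']
      | mem b y hy =>
        rw [hL a x hx, hL b y hy, hL _ _ (hlie a b x hx y hy), ExtendScalars.bracket_tmul,
          zpow_add, Units.val_mul]
  refine ⟨LinearMap.liftBaseChange _ L, ?_, ?_, ?_⟩
  · intro x y
    induction x with
    | zero => simp
    | add x x' hx hx' => simp [hx, hx']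
    | tmul a x =>
      induction y with
      | zero => simp
      | add x x' hx hx' => simp only [lie_add, map_add, hx, hx']
      | tmul b y => simp [hLie, mul_smul]; rw [smul_comm]
  · intro x
    induction x with
    | zero => simp
    | add x x' hx hx' => simp [hx, hx']
    | tmul a x =>
      have hx : x ∈ iSup W := by rw [htop]; trivial
      simp only [LinearMap.liftBaseChange_tmul, spec_smul, spec_tmul]
      congr 1
      induction hx using Submodule.iSup_induction' with
      | zero => simp
      | add x x' _ _ h h' => simp [h, h']
      | mem n x hx => rw [hL n x hx, spec_tmul, ev_zpow, ht0]; simp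
  · intro x
    induction x with
    | zero => simp
    | add x x' hx hx' => simp [hx, hx']
    | tmul a x =>
      have hx : x ∈ iSup W := by rw [htop]; trivial
      simp only [LinearMap.liftBaseChange_tmul, spec_smul, spec_tmul, map_smul]
      congr 1
      induction hx using Submodule.iSup_induction' with
      | zero => simp
      | add x x' _ _ h h' => simp [h, h']
      | mem n x hx => rw [hL n x hx, hτ n x hx, spec_tmul, ev_zpow, ht1]

lemma HasPath.exp {k A g : Type*} [Field k] [CharZero k] [CommRing A] [Algebra k A] {ev0 ev1 : A →ₐ[k] k} [LieRing g] [LieAlgebra k g]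
    (t : Aˣ) (ht0 : ev0 t = 1) (ht1 : ev1 t = 2) (n : g) (N : ℕ) (hN : (LieAlgebra.ad k g n) ^ (N + 1) = 0) :
    HasPath ev0 ev1 (∑ i ∈ Finset.range (N + 1), ((i.factorial : k))⁻¹ • (LieAlgebra.ad k g n) ^ i) := by
  let s : A := (t : A) - 1
  let : Module ℚ (A ⊗[k] g) := Module.compHom _ (algebraMap ℚ k)
  let : LieAlgebra ℚ (A ⊗[k] g) :=
    { lie_smul := fun t x y => lie_smul (algebraMap ℚ k t) x y }
  let D := LieDerivation.inner A (A ⊗[k] g) (A ⊗[k] g) (-(s ⊗ₜ n))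
  have hD : ∀ x, D x = ⁅s ⊗ₜ[k] n, x⁆ := by
    intro x; simp [D]
  have hpow : ∀ (i : ℕ) (a : A) (x : g), (D.toLinearMap ^ i) (a ⊗ₜ x) =
      (s ^ i * a) ⊗ₜ ((LieAlgebra.ad k g n) ^ i) x := by
    intro i a x
    induction i with
    | zero => simp
    | succ i ih =>
      rw [pow_succ', Module.End.mul_apply, ih]
      change D _ = _
      rw [hD, ExtendScalars.bracket_tmul, pow_succ' (LieAlgebra.ad k g n), Module.End.mul_apply,
        LieAlgebra.ad_apply, pow_succ', mul_assoc]
  have hDN : D.toLinearMap ^ (N + 1) = 0 := by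
    ext x
    simp [hpow, hN]
  have hnil : IsNilpotent D.toLinearMap := ⟨_, hDN⟩
  have hspec : ∀ (ev : A →ₐ[k] k) x, spec ev (LieDerivation.exp D hnil x) =
      ∑ i ∈ Finset.range (N + 1), ((i.factorial : k))⁻¹ • (ev t - 1) ^ i •
        ((LieAlgebra.ad k g n) ^ i) (spec ev x) := by
    intro ev x
    rw [LieDerivation.exp_map_apply, IsNilpotent.exp_eq_sum hDN, LinearMap.sum_apply, map_sum]
    refine Finset.sum_congr rfl fun i _ => ?_
    rw [LinearMap.smul_apply, inv_natCast_smul_eq ℚ k, map_smul]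
    congr 1
    induction x with
    | zero => simp
    | add x x' hx hx' => simp only [map_add, hx, hx', smul_add]
    | tmul a x =>
      rw [hpow, spec_tmul, spec_tmul, map_smul, map_mul, map_pow, mul_smul]
      simp [s]
  refine ⟨(LieDerivation.exp D hnil).toLinearEquiv.toLinearMap, fun x y => ?_, fun x => ?_, fun x => ?_⟩
  · exact LieEquiv.map_lie _ x y
  · refine (hspec ev0 x).trans ?_
    rw [Finset.sum_eq_single 0, ht0]
    · simp
    · intro i _ hi; simp [hi, ht0]
    · simp
  · refine (hspec ev1 x).trans ?_
    rw [LinearMap.sum_apply]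
    refine Finset.sum_congr rfl fun i _ => ?_
    have : ev1 t - 1 = 1 := by rw [ht1]; norm_num
    rw [this]; simp

open scoped LaurentPolynomial in
/-- Evaluation of Laurent polynomials at a unit. -/
noncomputable def evL {k : Type*} [Field k] (u : kˣ) : k[T;T⁻¹] →ₐ[k] k :=
  { LaurentPolynomial.eval₂ (RingHom.id k) u with
    commutes' := fun r => by
      simp }

open scoped LaurentPolynomial in
lemma evL_T {k : Type*} [Field k] (u : kˣ) (n : ℤ) :
    evL u (LaurentPolynomial.T n) = (u : k) ^ n := by
  have := LaurentPolynomial.eval₂_T (RingHom.id k) u n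
  rw [Units.val_zpow_eq_zpow_val] at this
  exact this


end DimPiece

namespace DimPiece

open scoped LaurentPolynomial

lemma pow_succ_finrank_eq_zero {k g : Type*} [Field k] [AddCommGroup g] [Module k g]
    [FiniteDimensional k g] (N : End k g) (h : IsNilpotent N) : N ^ (finrank k g + 1) = 0 := by
  obtain ⟨n, hn⟩ := h
  have h1 := (LinearMap.charpoly_eq_X_pow_iff N).2 fun m => ⟨n, by rw [hn]; rfl⟩
  have h2 := LinearMap.aeval_self_charpoly N
  rw [h1] at h2
  simp at h2
  rw [pow_succ, h2, zero_mul]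

lemma hasPath_of_mem_IntG {k A g : Type*} [Field k] [CharZero k] [CommRing A] [Algebra k A]
    {ev0 ev1 : A →ₐ[k] k} [LieRing g] [LieAlgebra k g] [FiniteDimensional k g]
    (t : Aˣ) (ht0 : ev0 t = 1) (ht1 : ev1 t = 2) (θ : g ≃ₗ[k] g) (hθ : θ ∈ IntG k g) :
    HasPath ev0 ev1 (θ : End k g) := by
  have hexp : ∀ n : g, IsNilpotent (LieAlgebra.ad k g n) →
      HasPath ev0 ev1 (expEnd k g (LieAlgebra.ad k g n)) := fun n hn =>
    HasPath.exp t ht0 ht1 n _ (pow_succ_finrank_eq_zero _ hn)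
  let : Module ℚ g := Module.compHom _ (algebraMap ℚ k)
  have hexpE : ∀ n : g, IsNilpotent (LieAlgebra.ad k g n) →
      expEnd k g (LieAlgebra.ad k g n) = IsNilpotent.exp (LieAlgebra.ad k g n) := by
    intro n hn
    rw [IsNilpotent.exp_eq_sum (pow_succ_finrank_eq_zero _ hn), expEnd]
    refine Finset.sum_congr rfl fun i _ => ?_
    rw [inv_natCast_smul_eq ℚ k]
  rw [IntG, ← Subgroup.mem_toSubmonoid, Subgroup.closure_toSubmonoid] at hθ
  induction hθ using Submonoid.closure_induction with
  | one => exact HasPath.one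
  | mul x y _ _ hx hy => exact hx.mul hy
  | mem x hx =>
    rcases hx with ⟨n, hn, h⟩ | ⟨n, hn, h⟩
    · rw [h]; exact hexp n hn
    · have hn' : IsNilpotent (LieAlgebra.ad k g (-n)) := by rw [map_neg]; exact hn.neg
      have : (x : End k g) = expEnd k g (LieAlgebra.ad k g (-n)) := by
        rw [hexpE _ hn', map_neg]
        rw [hexpE _ hn] at h
        have h1 : (x : End k g) * IsNilpotent.exp (LieAlgebra.ad k g n) = 1 := by
          rw [← h]
          ext y
          change x (x⁻¹ y) = y
          rw [← LinearEquiv.mul_apply, mul_inv_cancel]; rfl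
        calc (x : End k g) = x * (IsNilpotent.exp (LieAlgebra.ad k g n) *
              IsNilpotent.exp (-(LieAlgebra.ad k g n))) := by
              rw [hn.exp_mul_exp_neg_self, mul_one]
          _ = _ := by rw [← mul_assoc, h1, one_mul]
      rw [this]; exact hexp _ hn'

lemma rank_le_inner {k g : Type*} [Field k] [CharZero k] [IsAlgClosed k] [LieRing g]
    [LieAlgebra k g] [FiniteDimensional k g] [LieAlgebra.IsKilling k g]
    (θ : g ≃ₗ[k] g) (hθ : θ ∈ IntG k g)
    (W : ℤ → Submodule k g) (hind : iSupIndep W) (htop : iSup W = ⊤)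
    (hlie : ∀ a b, ∀ x ∈ W a, ∀ y ∈ W b, ⁅x, y⁆ ∈ W (a + b)) (τ : End k g)
    (hτ : ∀ n, ∀ x ∈ W n, τ x = (2 : k) ^ n • x) :
    LieAlgebra.rank k g ≤ finrank k (Module.End.maxGenEigenspace ((θ : End k g) * τ) 1) := by
  let t : k[T;T⁻¹]ˣ := ⟨LaurentPolynomial.T 1, LaurentPolynomial.T (-1),
    by rw [← LaurentPolynomial.T_add]; simp, by rw [← LaurentPolynomial.T_add]; simp⟩
  have ht0 : evL (1 : kˣ) (t : k[T;T⁻¹]) = 1 := by simp [t, evL_T]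
  have ht1 : evL (Units.mk0 (2 : k) two_ne_zero) (t : k[T;T⁻¹]) = 2 := by simp [t, evL_T]
  exact ((hasPath_of_mem_IntG t ht0 ht1 θ hθ).mul
    (HasPath.grading t ht0 ht1 W hind htop hlie τ hτ)).rank_le

end DimPiece

namespace DimPiece

lemma isSemisimple_ad_of_finrank {k g : Type*} [Field k] [CharZero k] [IsAlgClosed k] [LieRing g]
    [LieAlgebra k g] [FiniteDimensional k g] [LieAlgebra.IsKilling k g] (x : g)
    (hx : finrank k ((LieAlgebra.ad k g x).maxGenEigenspace 0) ≤ LieAlgebra.rank k g) :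
    (LieAlgebra.ad k g x).IsSemisimple := by
  have hx' : finrank k (LieSubalgebra.engel k x) ≤ LieAlgebra.rank k g := hx
  have : (LieSubalgebra.engel k x).IsCartanSubalgebra := by
    refine ⟨?_, LieSubalgebra.normalizer_engel _ _⟩
    apply LieSubalgebra.isNilpotent_of_forall_le_engel
    intro y hy
    set Ex : {LieSubalgebra.engel k z | z ∈ LieSubalgebra.engel k x} :=
      ⟨LieSubalgebra.engel k x, x, LieSubalgebra.self_mem_engel _ _, rfl⟩
    suffices IsBot Ex from @this ⟨LieSubalgebra.engel k y, y, hy, rfl⟩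
    apply LieAlgebra.engel_isBot_of_isMin
      (Cardinal.natCast_le_aleph0.trans <| Cardinal.infinite_iff.mp (inferInstance : Infinite k))
      (LieSubalgebra.engel k x) Ex le_rfl
    rintro ⟨_, y, hy, rfl⟩ hyx
    suffices finrank k (LieSubalgebra.engel k x) ≤ finrank k (LieSubalgebra.engel k y) by
      suffices LieSubalgebra.engel k y = LieSubalgebra.engel k x from this.ge
      apply LieSubalgebra.toSubmodule_injective
      exact Submodule.eq_of_le_of_finrank_le hyx this
    exact hx'.trans (LieAlgebra.rank_le_finrank_engel k y)
  exact LieAlgebra.IsKilling.isSemisimple_ad_of_mem_isCartanSubalgebra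
    (LieSubalgebra.self_mem_engel k x)

/-- Eigenvalues of `ad h` are integers. -/
lemma int_of_hasEigenvalue {k g : Type*} [Field k] [CharZero k] [LieRing g]
    [LieAlgebra k g] [FiniteDimensional k g] {h e f : g} (t : IsSl2Triple h e f)
    (hen : IsNilpotent (LieAlgebra.ad k g e)) (μ : k)
    (hμ : (LieAlgebra.ad k g h).HasEigenvalue μ) : ∃ n : ℤ, μ = n := by
  obtain ⟨v, hv⟩ := hμ.exists_hasEigenvector
  obtain ⟨N, hN⟩ := hen
  have hv1 : ⁅h, v⁆ = μ • v := hv.apply_eq_smul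
  have hex : ∃ j, ((LieModule.toEnd k g g e) ^ j) v = 0 := ⟨N, by
    change ((LieAlgebra.ad k g e) ^ N) v = 0
    rw [hN]; rfl⟩
  obtain ⟨j, hj1, hj2⟩ := Nat.exists_not_and_succ_of_not_zero_of_exists
    (p := fun j => ((LieModule.toEnd k g g e) ^ j) v = 0) hv.2 hex
  have P : t.HasPrimitiveVectorWith (((LieModule.toEnd k g g e) ^ j) v) (μ + 2 * j) :=
    ⟨hj1, t.lie_h_pow_toEnd_e hv1 j, by rw [IsSl2Triple.lie_e_pow_toEnd_e]; exact hj2⟩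
  obtain ⟨n, hn⟩ := P.exists_nat
  exact ⟨n - 2 * j, by push_cast; rw [← hn]; ring⟩

lemma finrank_add_le_of_grading {k g : Type*} [Field k] [AddCommGroup g]
    [Module k g] [FiniteDimensional k g] (W : ℤ → Submodule k g) (hind : iSupIndep W)
    (E : End k g) (hE : ∀ n, ∀ x ∈ W n, E x ∈ W (n + 2)) :
    finrank k (W 0) + finrank k (W 1) ≤ finrank k (LinearMap.ker E) := by
  let S : ℤ → Submodule k g := fun a => ⨆ n ∈ Set.Ici a, W n
  have h1 : ∀ a, finrank k (W a) + finrank k (S (a + 1)) ≤ finrank k (S a) := by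
    intro a
    have hd : Disjoint (W a) (S (a + 1)) := hind.disjoint_biSup (by simp)
    have hle : W a ⊔ S (a + 1) ≤ S a := by
      refine sup_le (le_biSup W (Set.mem_Ici.2 le_rfl)) ?_
      exact biSup_mono fun i hi => by simp only [Set.mem_Ici] at *; omega
    have := Submodule.finrank_sup_add_finrank_inf_eq (W a) (S (a + 1))
    rw [hd.eq_bot, finrank_bot, add_zero] at this
    rw [← this]
    exact Submodule.finrank_mono hle
  have h2 : Submodule.map E (S 0) ≤ S 2 := by
    simp only [S, Submodule.map_iSup]
    refine iSup₂_le fun n hn => ?_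
    refine le_trans ?_ (le_biSup W (i := n + 2) (by simp only [Set.mem_Ici] at *; omega))
    rintro _ ⟨x, hx, rfl⟩
    exact hE n x hx
  have h3 := LinearMap.finrank_range_add_finrank_ker (E.domRestrict (S 0))
  have h4 : finrank k (LinearMap.range (E.domRestrict (S 0))) ≤ finrank k (S 2) := by
    refine Submodule.finrank_mono (le_trans ?_ h2)
    rintro _ ⟨x, rfl⟩
    exact ⟨x, x.2, rfl⟩
  have h5 : finrank k (LinearMap.ker (E.domRestrict (S 0))) ≤ finrank k (LinearMap.ker E) := by
    refine LinearMap.finrank_le_finrank_of_injective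
      (f := ((S 0).subtype ∘ₗ (LinearMap.ker (E.domRestrict (S 0))).subtype).codRestrict
        (LinearMap.ker E) (fun x => x.2)) ?_
    intro x y hxy
    apply Subtype.ext; apply Subtype.ext
    have hxy1 := congrArg Subtype.val hxy
    exact hxy1
  have h6 := h1 0
  have h7 := h1 1
  rw [show (0 : ℤ) + 1 = 1 from rfl] at h6
  rw [show (1 : ℤ) + 1 = 2 from rfl] at h7
  omega

lemma exists_end_grading {k g : Type*} [Field k] [AddCommGroup g]
    [Module k g] (W : ℤ → Submodule k g) (hind : iSupIndep W) (htop : iSup W = ⊤) (χ : ℤ → k) :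
    ∃ D : End k g, ∀ n, ∀ x ∈ W n, D x = χ n • x := by
  classical
  have hint : DirectSum.IsInternal W :=
    DirectSum.isInternal_submodule_of_iSupIndep_of_iSup_eq_top hind htop
  let E := LinearEquiv.ofBijective (DirectSum.coeLinearMap W) hint
  let F : DirectSum ℤ (fun n => W n) →ₗ[k] g :=
    DirectSum.toModule k ℤ _ (fun n => χ n • (W n).subtype)
  refine ⟨F ∘ₗ E.symm.toLinearMap, fun n x hx => ?_⟩
  have : E.symm x = DirectSum.lof k ℤ (fun n => W n) n ⟨x, hx⟩ := by
    rw [LinearEquiv.symm_apply_eq]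
    exact (DirectSum.coeLinearMap_lof W n ⟨x, hx⟩).symm
  simp [this, F]

lemma grading_ext {k g V : Type*} [Field k] [AddCommGroup g] [Module k g] [AddCommGroup V]
    [Module k V] (W : ℤ → Submodule k g) (htop : iSup W = ⊤) (A B : g →ₗ[k] V)
    (h : ∀ n, ∀ x ∈ W n, A x = B x) : A = B := by
  ext x
  have hx : x ∈ iSup W := by rw [htop]; trivial
  induction hx using Submodule.iSup_induction' with
  | zero => simp
  | add x x' _ _ h h' => simp [h, h']
  | mem a x hx => exact h a x hx

/-- Fixed generalised vectors of `θ τ` lie in degree zero. -/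
lemma maxGen_le_zero_piece {k g : Type*} [Field k] [CharZero k] [AddCommGroup g]
    [Module k g] (W : ℤ → Submodule k g) (hind : iSupIndep W) (htop : iSup W = ⊤)
    (θ : g ≃ₗ[k] g) {m : ℕ} (hm : 1 ≤ m) (hθm : θ ^ m = 1) (hθW : ∀ n, ∀ x ∈ W n, θ x ∈ W n)
    (τ : End k g) (hτ : ∀ n, ∀ x ∈ W n, τ x = (2 : k) ^ n • x) :
    Module.End.maxGenEigenspace ((θ : End k g) * τ) 1 ≤ W 0 := by
  classical
  set σ : End k g := (θ : End k g) * τ with hσ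
  have hpow : ∀ j : ℕ, ∀ n, ∀ x ∈ W n, (σ ^ j) x = ((2 : k) ^ n) ^ j • ((θ ^ j : g ≃ₗ[k] g) x) ∧
      (θ ^ j : g ≃ₗ[k] g) x ∈ W n := by
    intro j
    induction j with
    | zero => intro n x hx; simpa using hx
    | succ j ih =>
      intro n x hx
      obtain ⟨h1, h2⟩ := ih n x hx
      constructor
      · rw [pow_succ', Module.End.mul_apply, h1, map_smul, hσ, Module.End.mul_apply, hτ n _ h2,
          map_smul, smul_smul, pow_succ, pow_succ' θ]
        rfl
      · rw [pow_succ']; exact hθW n _ h2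
  have hσm : ∀ n, ∀ x ∈ W n, (σ ^ m) x = ((2 : k) ^ n) ^ m • x := by
    intro n x hx
    rw [(hpow m n x hx).1, hθm]; rfl
  have hne : ∀ n : ℤ, n ≠ 0 → ((2 : k) ^ n) ^ m - 1 ≠ 0 := by
    intro n hn h
    rw [sub_eq_zero, ← zpow_natCast, ← zpow_mul] at h
    have h' : ((2 : ℚ) ^ (n * m)) = 1 := by
      have : (((2 : ℚ) ^ (n * m) : ℚ) : k) = ((1 : ℚ) : k) := by push_cast; exact h
      exact_mod_cast this
    have := (zpow_eq_one_iff_right₀ (by norm_num : (0 : ℚ) ≤ 2) (by norm_num)).1 h'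
    rcases mul_eq_zero.1 this with h | h
    · exact hn h
    · omega
  obtain ⟨Q, hQ⟩ := exists_end_grading W hind htop
    (fun n => if n = 0 then 0 else (((2 : k) ^ n) ^ m - 1)⁻¹)
  have hR : ∀ N, 1 ≤ N → ∀ n, ∀ x ∈ W n, (Q ^ N * (σ ^ m - 1) ^ N) x = if n = 0 then 0 else x := by
    intro N hN
    induction N, hN using Nat.le_induction with
    | base =>
      intro n x hx
      rw [pow_one, pow_one, Module.End.mul_apply, LinearMap.sub_apply, hσm n x hx, map_sub, map_smul,
        Module.End.one_apply, hQ n x hx]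
      split_ifs with h0
      · simp
      · rw [smul_smul, ← sub_smul]
        have := hne n h0
        rw [show ((2 : k) ^ n) ^ m * (((2 : k) ^ n) ^ m - 1)⁻¹ - (((2 : k) ^ n) ^ m - 1)⁻¹ = 1 by
          field_simp, one_smul]
    | succ N hN ih =>
      intro n x hx
      have h1 : (σ ^ m - 1) x = (((2 : k) ^ n) ^ m - 1) • x := by
        rw [LinearMap.sub_apply, hσm n x hx, sub_smul, one_smul]; rfl
      have h2 := ih n x hx
      rw [Module.End.mul_apply] at h2
      rw [pow_succ' Q, pow_succ, Module.End.mul_apply, Module.End.mul_apply, Module.End.mul_apply,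
        h1, map_smul, map_smul, h2]
      split_ifs with h0
      · simp
      · rw [map_smul, hQ n x hx, if_neg h0, smul_smul, mul_inv_cancel₀ (hne n h0), one_smul]
  obtain ⟨Pr, hPr⟩ := exists_end_grading W hind htop (fun n => if n = 0 then 1 else 0)
  have hP0 : ∀ x, Pr x ∈ W 0 := by
    intro x
    have hx : x ∈ iSup W := by rw [htop]; trivial
    induction hx using Submodule.iSup_induction' with
    | zero => simp
    | add x x' _ _ h h' => rw [map_add]; exact add_mem h h'
    | mem a x hx =>
      rw [hPr a x hx]
      split_ifs with h0
      · subst h0; simpa using hx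
      · simp
  intro x hx
  rw [Module.End.mem_maxGenEigenspace] at hx
  obtain ⟨N, hN⟩ := hx
  have hN1 : ((σ ^ m - 1) ^ (N + 1)) x = 0 := by
    have hc : (σ ^ m - 1) = (∑ i ∈ Finset.range m, σ ^ i) * (σ - 1) := (geom_sum_mul σ m).symm
    have hcomm : Commute (∑ i ∈ Finset.range m, σ ^ i) (σ - 1) := by
      refine Commute.sub_right (Commute.sum_left _ _ _ fun i _ => (Commute.refl σ).pow_left i)
        (Commute.one_right _)
    rw [one_smul] at hN
    rw [hc, hcomm.mul_pow, Module.End.mul_apply, pow_succ' (σ - 1), Module.End.mul_apply, hN]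
    simp
  have hid : Q ^ (N + 1) * (σ ^ m - 1) ^ (N + 1) = 1 - Pr := by
    refine grading_ext W htop _ _ fun n x hx => ?_
    rw [hR (N + 1) (by omega) n x hx, LinearMap.sub_apply, hPr n x hx]
    split_ifs <;> simp
  have := congrArg (fun A => A x) hid
  simp only [Module.End.mul_apply, hN1, map_zero, LinearMap.sub_apply, Module.End.one_apply] at this
  rw [sub_eq_zero.1 this.symm]
  exact hP0 x

end DimPiece

namespace DimPiece

lemma theta_isSemisimple {k g : Type*} [Field k] [CharZero k] [AddCommGroup g]
    [Module k g] (θ : g ≃ₗ[k] g) {m : ℕ} (hm : 1 ≤ m) (hθm : θ ^ m = 1) :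
    Module.End.IsSemisimple (θ : End k g) := by
  have hm0 : (m : k) ≠ 0 := by exact_mod_cast (by omega : m ≠ 0)
  refine Module.End.isSemisimple_of_squarefree_aeval_eq_zero
    (p := (Polynomial.X ^ m - 1 : Polynomial k)) ?_ ?_
  · exact (Polynomial.separable_X_pow_sub_C (1 : k) hm0 one_ne_zero).squarefree
  · have h1 : (θ : End k g) ^ m = 1 := by
      ext x
      have : ∀ j : ℕ, ((θ : End k g) ^ j) x = (θ ^ j : g ≃ₗ[k] g) x := by
        intro j
        induction j with
        | zero => rfl
        | succ j ih => rw [pow_succ', Module.End.mul_apply, ih, pow_succ']; rfl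
      rw [this, hθm]; rfl
    simp [h1]

lemma structure_main {k g : Type*} [Field k] [CharZero k] [IsAlgClosed k] [LieRing g]
    [LieAlgebra k g] [FiniteDimensional k g] [LieAlgebra.IsKilling k g]
    {m : ℕ} (hm : 1 ≤ m)
    (θ : g ≃ₗ[k] g) (hθb : ∀ x y : g, θ ⁅x, y⁆ = ⁅θ x, θ y⁆) (hθm : θ ^ m = 1)
    (hθ : θ ∈ IntG k g) {e h f : g} (t : IsSl2Triple h e f)
    (hhe : ⁅h, e⁆ = (2 : k) • e) (hθh : θ h = h)
    (hen : IsNilpotent (LieAlgebra.ad k g e))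
    (her : finrank k (LinearMap.ker (LieAlgebra.ad k g e)) = LieAlgebra.rank k g) :
    (LieAlgebra.ad k g h).IsSemisimple ∧ (∀ x : g, ⁅h, x⁆ = x → x = 0) ∧
      (∀ x : g, ⁅h, x⁆ = 0 → θ x = x) := by
  set H := LieAlgebra.ad k g h with hH
  let W : ℤ → Submodule k g := fun n => H.maxGenEigenspace (n : k)
  have hind : iSupIndep W :=
    H.independent_maxGenEigenspace.comp Int.cast_injective
  have htop : iSup W = ⊤ := by
    rw [eq_top_iff, ← H.iSup_maxGenEigenspace_eq_top]
    refine iSup_le fun μ => ?_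
    by_cases hμ : H.HasEigenvalue μ
    · obtain ⟨n, rfl⟩ := int_of_hasEigenvalue t hen μ hμ
      exact le_iSup W n
    · intro z hz
      rw [eq_zero_of_genEigen H μ hμ z hz]
      exact zero_mem _
  have hlie : ∀ a b, ∀ x ∈ W a, ∀ y ∈ W b, ⁅x, y⁆ ∈ W (a + b) := by
    intro a b x hx y hy
    have := LieModule.lie_mem_maxGenEigenspace_toEnd (R := k) (L := g) (M := g) (x := h) hx hy
    simp only [W]
    push_cast
    exact this
  have heW : e ∈ W 2 := by
    simp only [W]
    rw [Module.End.mem_maxGenEigenspace]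
    refine ⟨1, ?_⟩
    simp [hH, hhe]
  have hθW : ∀ n, ∀ x ∈ W n, θ x ∈ W n := by
    intro n x hx
    simp only [W] at hx ⊢
    rw [Module.End.mem_maxGenEigenspace] at hx ⊢
    obtain ⟨N, hN⟩ := hx
    refine ⟨N, ?_⟩
    have hc : ∀ j : ℕ, ∀ y, ((H - (n : k) • 1) ^ j) (θ y) = θ (((H - (n : k) • 1) ^ j) y) := by
      intro j
      induction j with
      | zero => intro y; rfl
      | succ j ih =>
        intro y
        rw [pow_succ, Module.End.mul_apply, Module.End.mul_apply, ← ih]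
        congr 1
        simp [hH, hθb, hθh]
    rw [hc, hN, map_zero]
  have h01 : finrank k (W 0) + finrank k (W 1) ≤ LieAlgebra.rank k g := by
    rw [← her]
    refine finrank_add_le_of_grading W hind _ fun n x hx => ?_
    have := hlie 2 n e heW x hx
    rw [add_comm] at this
    exact this
  obtain ⟨τ, hτ⟩ := exists_end_grading W hind htop (fun n => (2 : k) ^ n)
  have hr := rank_le_inner θ hθ W hind htop hlie τ hτ
  have hle := maxGen_le_zero_piece W hind htop θ hm hθm hθW τ hτ
  have hfr := Submodule.finrank_mono hle
  have hW1 : W 1 = ⊥ := by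
    rw [← Submodule.finrank_eq_zero (R := k)]
    omega
  have heq : Module.End.maxGenEigenspace ((θ : End k g) * τ) 1 = W 0 :=
    Submodule.eq_of_le_of_finrank_le hle (by omega)
  have hW0 : W 0 = H.maxGenEigenspace 0 := by simp [W]
  refine ⟨isSemisimple_ad_of_finrank h ?_, ?_, ?_⟩
  · rw [← hH, ← hW0]; omega
  · intro x hx
    have : x ∈ W 1 := by
      simp only [W]
      rw [Module.End.mem_maxGenEigenspace]
      exact ⟨1, by simp [hH, hx]⟩
    rw [hW1] at this
    simpa using this
  · intro x hx
    have hx0 : x ∈ W 0 := by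
      simp only [W]
      rw [Module.End.mem_maxGenEigenspace]
      exact ⟨1, by simp [hH, hx]⟩
    have hx1 := hx0
    rw [← heq, Module.End.mem_maxGenEigenspace] at hx1
    obtain ⟨N, hN⟩ := hx1
    have hc : ∀ j : ℕ, ∀ y ∈ W 0, (((θ : End k g) * τ - (1 : k) • 1) ^ j) y =
        (((θ : End k g) - (1 : k) • 1) ^ j) y := by
      intro j
      induction j with
      | zero => intro y _; rfl
      | succ j ih =>
        intro y hy
        have h1 : ((θ : End k g) * τ - (1 : k) • 1) y = ((θ : End k g) - (1 : k) • 1) y := by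
          simp [hτ 0 y hy]
        rw [pow_succ, Module.End.mul_apply, h1, ih, pow_succ, Module.End.mul_apply]
        simpa using sub_mem (hθW 0 y hy) hy
    rw [hc N x hx0] at hN
    have hx2 : x ∈ Module.End.maxGenEigenspace (θ : End k g) 1 := by
      rw [Module.End.mem_maxGenEigenspace]; exact ⟨N, hN⟩
    rw [(theta_isSemisimple θ hm hθm).isFinitelySemisimple.maxGenEigenspace_eq_eigenspace,
      Module.End.mem_eigenspace_iff] at hx2
    simpa using hx2

/-- The action of `θ` on homogeneous elements of `z(e)`. -/
lemma theta_on_ze {k g : Type*} [Field k] [CharZero k] [LieRing g]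
    [LieAlgebra k g] [FiniteDimensional k g] (ζ : k) (hζ : ζ ≠ 0)
    (θ : g ≃ₗ[k] g) (hθb : ∀ x y : g, θ ⁅x, y⁆ = ⁅θ x, θ y⁆)
    {e h f : g} (t : IsSl2Triple h e f) (hθh : θ h = h) (hθe : θ e = ζ • e)
    (hθf : θ f = ζ⁻¹ • f) (hW1 : ∀ x : g, ⁅h, x⁆ = x → x = 0) (hW0 : ∀ x : g, ⁅h, x⁆ = 0 → θ x = x)
    (v : g) (hv : v ≠ 0) (hev : ⁅e, v⁆ = 0) (μ : k) (hμ : ⁅h, v⁆ = μ • v) :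
    ∃ c : ℕ, μ = 2 * c ∧ θ v = ζ ^ c • v := by
  have P : t.HasPrimitiveVectorWith v μ := ⟨hv, hμ, hev⟩
  obtain ⟨n, hn⟩ := P.exists_nat
  obtain ⟨c, hc | hc⟩ := Nat.even_or_odd' n
  · refine ⟨c, by rw [hn, hc]; push_cast; ring, ?_⟩
    by_contra hne
    rw [← sub_eq_zero] at hne
    have hev' : ⁅e, θ v⁆ = 0 := by
      have := hθb e v
      rw [hev, hθe, smul_lie, map_zero] at this
      exact (smul_eq_zero.1 this.symm).resolve_left hζ
    have hhv' : ⁅h, θ v⁆ = μ • θ v := by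
      have := hθb h v
      rw [hμ, hθh, map_smul] at this
      exact this.symm
    have P' : t.HasPrimitiveVectorWith (θ v - ζ ^ c • v) μ := by
      refine ⟨hne, ?_, ?_⟩
      · rw [lie_sub, lie_smul, hhv', hμ, smul_sub, smul_comm]
      · rw [lie_sub, lie_smul, hev', hev]; simp
    apply P'.pow_toEnd_f_ne_zero_of_eq_nat hn (i := c) (by omega)
    have hfix := hW0 (((LieModule.toEnd k g g f) ^ c) v) (by
      rw [P.lie_h_pow_toEnd_f, hn, hc]; push_cast; simp)
    have hθf' : ∀ j : ℕ, θ (((LieModule.toEnd k g g f) ^ j) v) =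
        (ζ⁻¹) ^ j • ((LieModule.toEnd k g g f) ^ j) (θ v) := by
      intro j
      induction j with
      | zero => simp
      | succ j ih =>
        rw [pow_succ', Module.End.mul_apply, Module.End.mul_apply, LieModule.toEnd_apply_apply,
          LieModule.toEnd_apply_apply, hθb, ih, hθf, smul_lie, lie_smul, smul_smul, pow_succ']
    rw [hθf'] at hfix
    rw [map_sub, map_smul, ← hfix, smul_smul, ← mul_pow, mul_inv_cancel₀ hζ]
    simp
  · exfalso
    apply P.pow_toEnd_f_ne_zero_of_eq_nat hn (i := c) (by omega)
    apply hW1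
    rw [P.lie_h_pow_toEnd_f, hn, hc]
    push_cast
    rw [show (2 * (c : k) + 1 - 2 * c) = 1 by ring, one_smul]

end DimPiece

namespace DimPiece

lemma finrank_iSup_eq_finsum {k g : Type*} [Field k] [AddCommGroup g] [Module k g]
    [FiniteDimensional k g] (Y : ℤ → Submodule k g) (hY : iSupIndep Y) :
    finrank k ↥(⨆ c, Y c) = ∑ᶠ c, finrank k (Y c) := by
  classical
  have hfin := WellFoundedGT.finite_ne_bot_of_iSupIndep hY
  have hs : ∀ s : Finset ℤ, finrank k ↥(⨆ c ∈ s, Y c) = ∑ c ∈ s, finrank k (Y c) := by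
    intro s
    induction s using Finset.induction_on with
    | empty => simp
    | insert a s ha ih =>
      rw [Finset.iSup_insert, Finset.sum_insert ha, ← ih]
      have hd : Disjoint (Y a) (⨆ c ∈ s, Y c) := hY.disjoint_biSup (y := (s : Set ℤ)) (by simpa)
      have := Submodule.finrank_sup_add_finrank_inf_eq (Y a) (⨆ c ∈ s, Y c)
      rwa [hd.eq_bot, finrank_bot, add_zero] at this
  rw [finsum_eq_sum_of_support_subset (s := hfin.toFinset), ← hs]
  · have heq : (⨆ c, Y c) = ⨆ c ∈ hfin.toFinset, Y c := ?_
    · rw [heq]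
    apply le_antisymm
    · refine iSup_le fun c => ?_
      by_cases hc : Y c = ⊥
      · rw [hc]; exact bot_le
      · exact le_biSup Y (by simpa using hc)
    · exact iSup₂_le fun c _ => le_iSup Y c
  · intro c hc
    simp only [Set.Finite.coe_toFinset, Set.mem_ofPred_eq]
    intro h0
    simp [h0] at hc

lemma zmod_pow_eq {k : Type*} [Field k] {m : ℕ} (hm : 1 ≤ m) {ζ : k} (hζ : IsPrimitiveRoot ζ m)
    (i : ZMod m) (c : ℕ) : ζ ^ c = ζ ^ i.val ↔ (c : ZMod m) = i := by
  have : NeZero m := ⟨by omega⟩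
  have hu := hζ.isUnit (by omega)
  obtain ⟨u, rfl⟩ := hu
  have hu : IsPrimitiveRoot u m := IsPrimitiveRoot.coe_units_iff.1 hζ
  rw [← Units.val_pow_eq_pow_val, ← Units.val_pow_eq_pow_val, Units.val_inj, pow_eq_pow_iff_modEq,
    ← hu.eq_orderOf, ← ZMod.natCast_eq_natCast_iff, ZMod.natCast_zmod_val]

lemma kNum_eq {k g : Type*} [Field k] [CharZero k] [IsAlgClosed k] [LieRing g]
    [LieAlgebra k g] [FiniteDimensional k g] {m : ℕ} (hm : 1 ≤ m) {ζ : k}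
    (hζ : IsPrimitiveRoot ζ m)
    (θ : g ≃ₗ[k] g) (hθb : ∀ x y : g, θ ⁅x, y⁆ = ⁅θ x, θ y⁆)
    {e h f : g} (t : IsSl2Triple h e f) (hhe : ⁅h, e⁆ = (2 : k) • e)
    (hθh : θ h = h) (hθe : θ e = ζ • e)
    (hθf : θ f = ζ⁻¹ • f) (hss : (LieAlgebra.ad k g h).IsSemisimple)
    (hW1 : ∀ x : g, ⁅h, x⁆ = x → x = 0) (hW0 : ∀ x : g, ⁅h, x⁆ = 0 → θ x = x)
    (i : ZMod m) :
    kNum k g m e h i = finrank k ↥(zc k g e ⊓ gradePiece k g ζ θ i) := by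
  classical
  have hζ0 : ζ ≠ 0 := (hζ.isUnit (by omega)).ne_zero
  have key := theta_on_ze ζ hζ0 θ hθb t hθh hθe hθf hW1 hW0
  set H := LieAlgebra.ad k g h with hH
  let Y : ℤ → Submodule k g := fun c => if (c : ZMod m) = i then
    zc k g e ⊓ Module.End.eigenspace H (2 * (c : k)) else ⊥
  have hYle : ∀ c, Y c ≤ Module.End.eigenspace H (2 * (c : k)) := by
    intro c
    simp only [Y]
    split_ifs
    · exact inf_le_right
    · exact bot_le
  have hY : iSupIndep Y := by
    refine iSupIndep.mono ?_ hYle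
    refine (Module.End.eigenspaces_iSupIndep H).comp (f := fun c : ℤ => 2 * (c : k)) ?_
    intro a b hab
    simpa using hab
  have hk : kNum k g m e h i = ∑ᶠ c, finrank k (Y c) := by
    unfold kNum
    refine finsum_congr fun c => ?_
    by_cases hc : (c : ZMod m) = i
    · have h1 : Y c = zc k g e ⊓ Module.End.eigenspace H (2 * (c : k)) := if_pos hc
      rw [h1, if_pos hc]
    · have h1 : Y c = ⊥ := if_neg hc
      rw [h1, if_neg hc, finrank_bot]
  rw [hk, ← finrank_iSup_eq_finsum Y hY]
  have hmem : ∀ v, v ∈ zc k g e ↔ ⁅e, v⁆ = 0 := fun v => by simp [zc]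
  have hmem2 : ∀ v, v ∈ gradePiece k g ζ θ i ↔ θ v = ζ ^ i.val • v := fun v => by
    simp [gradePiece, Module.End.mem_eigenspace_iff]
  have hmem3 : ∀ v μ, v ∈ Module.End.eigenspace H μ ↔ ⁅h, v⁆ = μ • v := fun v μ => by
    simp [hH, Module.End.mem_eigenspace_iff]
  have heq : (⨆ c, Y c) = zc k g e ⊓ gradePiece k g ζ θ i := ?_
  · rw [heq]
  apply le_antisymm
  · refine iSup_le fun c => ?_
    simp only [Y]
    split_ifs with hc
    · rintro v ⟨hv1, hv2⟩
      refine ⟨hv1, ?_⟩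
      by_cases hv0 : v = 0
      · rw [hv0]; exact zero_mem _
      obtain ⟨c', hc', hθv⟩ := key v hv0 ((hmem v).1 hv1) _ ((hmem3 _ _).1 hv2)
      have hcc : c = c' := by
        have h1 : (c : k) = ((c' : ℤ) : k) := by
          push_cast
          exact mul_left_cancel₀ two_ne_zero hc'
        exact_mod_cast h1
      refine (hmem2 v).2 ?_
      rw [hθv, (zmod_pow_eq hm hζ i c').2]
      rw [← hc, hcc]; simp
    · exact bot_le
  · have hinv : ∀ x ∈ zc k g e ⊓ gradePiece k g ζ θ i, H x ∈ zc k g e ⊓ gradePiece k g ζ θ i := by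
      rintro x ⟨hx1, hx2⟩
      replace hx1 := (hmem x).1 hx1
      replace hx2 := (hmem2 x).1 hx2
      refine ⟨(hmem _).2 ?_, (hmem2 _).2 ?_⟩
      · change ⁅e, ⁅h, x⁆⁆ = 0
        rw [leibniz_lie, hx1, ← lie_skew e h, hhe, neg_lie, smul_lie, hx1]; simp
      · change θ ⁅h, x⁆ = _ • ⁅h, x⁆
        rw [hθb, hθh, hx2, lie_smul]
    have htop : ⨆ μ, H.genEigenspace μ 1 = ⊤ := by
      have := H.iSup_maxGenEigenspace_eq_top
      simpa only [hss.isFinitelySemisimple.maxGenEigenspace_eq_eigenspace] using this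
    rw [Submodule.eq_iSup_inf_genEigenspace 1 hinv htop]
    refine iSup_le fun μ => ?_
    rintro v ⟨⟨hv1, hv2⟩, hv3⟩
    by_cases hv0 : v = 0
    · rw [hv0]; exact zero_mem _
    obtain ⟨c, rfl, hθv⟩ := key v hv0 ((hmem v).1 hv1) μ ((hmem3 _ _).1 hv3)
    have hc : (c : ZMod m) = i := by
      rw [← zmod_pow_eq hm hζ]
      have h2 := (hmem2 v).1 hv2
      rw [hθv] at h2
      exact smul_left_injective k hv0 h2
    refine (le_iSup Y (c : ℤ)) ?_
    simp only [Y]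
    rw [if_pos (by simpa using hc)]
    exact ⟨hv1, by simpa using hv3⟩

lemma finrank_bilin {k V U : Type*} [Field k] [AddCommGroup V] [Module k V] [AddCommGroup U]
    [Module k U] [FiniteDimensional k V] [FiniteDimensional k U] (B : V →ₗ[k] U →ₗ[k] k) :
    finrank k V + finrank k (LinearMap.ker B.flip) = finrank k U + finrank k (LinearMap.ker B) := by
  have h1 := LinearMap.finrank_range_add_finrank_ker B
  have h2 := LinearMap.finrank_range_add_finrank_ker B.flip
  have h3 : finrank k (LinearMap.range B.flip) = finrank k (LinearMap.range B) := by
    rw [← LinearMap.finrank_range_dualMap_eq_finrank_range B]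
    have : B.flip = B.dualMap ∘ₗ (Module.evalEquiv k U).toLinearMap := by
      ext u v; simp
    rw [this, LinearMap.range_comp_of_range_eq_top]
    exact LinearEquiv.range _
  omega

section killing

variable {k g : Type*} [Field k] [CharZero k] [IsAlgClosed k] [LieRing g]
    [LieAlgebra k g] [FiniteDimensional k g] [LieAlgebra.IsKilling k g]

lemma killing_theta (θ : g ≃ₗ[k] g) (hθb : ∀ x y : g, θ ⁅x, y⁆ = ⁅θ x, θ y⁆) (x y : g) :
    killingForm k g (θ x) (θ y) = killingForm k g x y := by
  let E : g ≃ₗ⁅k⁆ g := { θ with map_lie' := fun {x y} => hθb x y }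
  exact LieAlgebra.killingForm_of_equiv_apply E x y

lemma killing_eq_zero (θ : g ≃ₗ[k] g) (hθb : ∀ x y : g, θ ⁅x, y⁆ = ⁅θ x, θ y⁆)
    {m : ℕ} (hm : 1 ≤ m) (hθm : θ ^ m = 1) (a : k) (ha : a ≠ 0) (x : g) (hx : θ x = a • x)
    (h : ∀ y : g, θ y = a⁻¹ • y → killingForm k g x y = 0) : x = 0 := by
  apply (LieAlgebra.IsKilling.killingForm_nondegenerate k g).1
  intro y
  have hy : y ∈ ⨆ μ, Module.End.maxGenEigenspace (θ : End k g) μ := by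
    rw [Module.End.iSup_maxGenEigenspace_eq_top]; trivial
  simp only [(theta_isSemisimple θ hm hθm).isFinitelySemisimple.maxGenEigenspace_eq_eigenspace]
    at hy
  induction hy using Submodule.iSup_induction' with
  | zero => simp
  | add y y' _ _ h h' => simp [h, h']
  | mem μ y hy =>
    rw [Module.End.mem_eigenspace_iff] at hy
    replace hy : θ y = μ • y := hy
    by_cases hμ : μ = a⁻¹
    · exact h y (by rw [hy, hμ])
    · have h1 := killing_theta θ hθb x y
      rw [hx, hy] at h1
      simp only [map_smul, LinearMap.smul_apply, smul_eq_mul] at h1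
      have h2 : (a * μ - 1) * killingForm k g x y = 0 := by linear_combination h1
      refine (mul_eq_zero.1 h2).resolve_left fun h3 => hμ ?_
      field_simp
      linear_combination h3

lemma finrank_eigen_relation (θ : g ≃ₗ[k] g) (hθb : ∀ x y : g, θ ⁅x, y⁆ = ⁅θ x, θ y⁆)
    {m : ℕ} (hm : 1 ≤ m) (hθm : θ ^ m = 1) (ζ : k) (hζ : ζ ≠ 0) (e : g) (hθe : θ e = ζ • e)
    (a : k) (ha : a ≠ 0) (E : k → Submodule k g)
    (hE : ∀ a x, x ∈ E a ↔ θ x = a • x) :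
    finrank k (E (ζ * a)) + finrank k ↥(zc k g e ⊓ E a) =
      finrank k (E a) + finrank k ↥(zc k g e ⊓ E (ζ * a)⁻¹) := by
  have hza : ζ * a ≠ 0 := mul_ne_zero hζ ha
  have hcomm : ∀ x y, killingForm k g x y = killingForm k g y x :=
    fun x y => LieModule.traceForm_comm k g g x y
  have hinv : ∀ x y, killingForm k g ⁅e, x⁆ y = - killingForm k g x ⁅e, y⁆ :=
    fun x y => LieModule.traceForm_apply_lie_apply' k g g e x y
  have hbr : ∀ a x, x ∈ E a → ⁅e, x⁆ ∈ E (ζ * a) := by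
    intro a x hx
    rw [hE] at hx ⊢
    rw [hθb, hθe, hx, smul_lie, lie_smul, smul_smul]
  have hmem : ∀ v, v ∈ zc k g e ↔ ⁅e, v⁆ = 0 := fun v => by simp [zc]
  have hnd : ∀ a, a ≠ 0 → ∀ x ∈ E a, (∀ y ∈ E a⁻¹, killingForm k g x y = 0) → x = 0 := by
    intro a ha x hx h
    exact killing_eq_zero θ hθb hm hθm a ha x ((hE _ _).1 hx) fun y hy => h y ((hE _ _).2 hy)
  -- first pairing
  have hA : finrank k (E (ζ * a)) = finrank k (E (ζ * a)⁻¹) := by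
    let B : E (ζ * a) →ₗ[k] E (ζ * a)⁻¹ →ₗ[k] k :=
      (killingForm k g).domRestrict₁₂ (E (ζ * a)) (E (ζ * a)⁻¹)
    have h1 : LinearMap.ker B = ⊥ := by
      rw [LinearMap.ker_eq_bot']
      intro x hx
      apply Subtype.ext
      refine hnd _ hza x x.2 fun y hy => ?_
      exact LinearMap.congr_fun hx ⟨y, hy⟩
    have h2 : LinearMap.ker B.flip = ⊥ := by
      rw [LinearMap.ker_eq_bot']
      intro x hx
      apply Subtype.ext
      refine hnd _ (inv_ne_zero hza) x x.2 fun y hy => ?_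
      rw [inv_inv] at hy
      rw [hcomm]
      exact LinearMap.congr_fun hx ⟨y, hy⟩
    have := finrank_bilin B
    rw [h1, h2] at this
    simpa using this
  -- second pairing
  let B : E a →ₗ[k] E (ζ * a)⁻¹ →ₗ[k] k :=
    (LinearMap.comp (killingForm k g) (LieAlgebra.ad k g e)).domRestrict₁₂ (E a) (E (ζ * a)⁻¹)
  have hB : ∀ x y, B x y = killingForm k g ⁅e, (x : g)⁆ (y : g) := fun x y => rfl
  have h1 : Submodule.map (E a).subtype (LinearMap.ker B) = zc k g e ⊓ E a := by
    ext x
    constructor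
    · rintro ⟨x, hx, rfl⟩
      refine ⟨(hmem _).2 ?_, x.2⟩
      refine hnd _ hza _ (hbr a x x.2) fun y hy => ?_
      exact LinearMap.congr_fun hx ⟨y, hy⟩
    · rintro ⟨hx1, hx2⟩
      refine ⟨⟨x, hx2⟩, ?_, rfl⟩
      ext y
      rw [hB]
      simp [(hmem x).1 hx1]
  have h2 : Submodule.map (E (ζ * a)⁻¹).subtype (LinearMap.ker B.flip) =
      zc k g e ⊓ E (ζ * a)⁻¹ := by
    ext y
    constructor
    · rintro ⟨y, hy, rfl⟩
      refine ⟨(hmem _).2 ?_, y.2⟩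
      have h3 := hbr _ y y.2
      rw [show ζ * (ζ * a)⁻¹ = a⁻¹ by field_simp] at h3
      refine hnd _ (inv_ne_zero ha) _ h3 fun x hx => ?_
      rw [inv_inv] at hx
      have h4 : killingForm k g ⁅e, x⁆ (y : g) = 0 := LinearMap.congr_fun hy ⟨x, hx⟩
      rw [hinv, neg_eq_zero] at h4
      rw [hcomm]
      exact h4
    · rintro ⟨hy1, hy2⟩
      refine ⟨⟨y, hy2⟩, ?_, rfl⟩
      ext x
      rw [LinearMap.flip_apply, hB, hinv]
      simp [(hmem y).1 hy1]
  have h3 := finrank_bilin B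
  rw [← Submodule.finrank_map_subtype_eq (E a) (LinearMap.ker B),
    ← Submodule.finrank_map_subtype_eq _ (LinearMap.ker B.flip), h1, h2] at h3
  omega

lemma main_killing
    {m : ℕ} (hm : 1 ≤ m) {ζ : k} (hζ : IsPrimitiveRoot ζ m)
    (θ : g ≃ₗ[k] g) (hθb : ∀ x y : g, θ ⁅x, y⁆ = ⁅θ x, θ y⁆) (hθm : θ ^ m = 1)
    (hθinner : θ ∈ IntG k g)
    (e h f : g)
    (hhe : ⁅h, e⁆ = (2 : k) • e) (hhf : ⁅h, f⁆ = -((2 : k) • f)) (hef : ⁅e, f⁆ = h)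
    (hθe : θ e = ζ • e) (hθh : θ h = h) (hθf : θ f = ζ⁻¹ • f)
    (hen : IsNilpotent (LieAlgebra.ad k g e))
    (her : Module.finrank k (zc k g e) = LieAlgebra.rank k g)
    (i : ZMod m) :
    (Module.finrank k (gradePiece k g ζ θ (i + 1)) : ℤ)
        - Module.finrank k (gradePiece k g ζ θ i)
      = (kNum k g m e h (-i - 1) : ℤ) - kNum k g m e h i := by
  have : NeZero m := ⟨by omega⟩
  have hζ0 : ζ ≠ 0 := (hζ.isUnit (by omega)).ne_zero
  by_cases hh : h = 0
  · -- degenerate case: `g` is trivial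
    have he0 : e = 0 := by
      rw [hh, zero_lie] at hhe
      exact (smul_eq_zero.1 hhe.symm).resolve_left two_ne_zero
    have hsub : Subsingleton g := by
      have hfr : finrank k g = LieAlgebra.rank k g := by
        have hz : zc k g (0 : g) = ⊤ := by
          ext x
          simp [zc]
        rw [← her, he0, hz, finrank_top]
      have hss : ∀ x : g, (LieAlgebra.ad k g x).IsSemisimple := fun x =>
        isSemisimple_ad_of_finrank x ((Submodule.finrank_le _).trans hfr.le)
      have hnil : ∀ x : g, LieAlgebra.ad k g x = 0 := by
        intro x
        refine Module.End.eq_zero_of_isNilpotent_isSemisimple ?_ (hss x)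
        have htop : LieSubalgebra.engel k x = ⊤ := by
          apply LieSubalgebra.toSubmodule_injective
          apply Submodule.eq_top_of_finrank_eq
          refine le_antisymm (Submodule.finrank_le _) ?_
          rw [hfr]
          exact LieAlgebra.rank_le_finrank_engel k x
        rw [Module.End.isNilpotent_iff_of_finite]
        intro y
        have : y ∈ LieSubalgebra.engel k x := by rw [htop]; trivial
        exact (LieSubalgebra.mem_engel_iff k x y).1 this
      refine subsingleton_of_forall_eq 0 fun x => ?_
      apply (LieAlgebra.IsKilling.killingForm_nondegenerate k g).1
      intro y
      simp [killingForm_apply_apply, hnil]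
    have h0 : ∀ S : Submodule k g, finrank k S = 0 := fun S => finrank_zero_of_subsingleton
    simp [h0, kNum]
  have t : IsSl2Triple h e f := ⟨hh, hef, by rw [hhe, two_smul, two_nsmul],
    by rw [hhf, two_smul, two_nsmul]⟩
  obtain ⟨hss, hW1, hW0⟩ := structure_main hm θ hθb hθm hθinner t hhe hθh hen her
  rw [kNum_eq hm hζ θ hθb t hhe hθh hθe hθf hss hW1 hW0,
    kNum_eq hm hζ θ hθb t hhe hθh hθe hθf hss hW1 hW0]
  have hrel := finrank_eigen_relation θ hθb hm hθm ζ hζ0 e hθe (ζ ^ i.val) (pow_ne_zero _ hζ0)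
    (fun a => Module.End.eigenspace (θ : End k g) a)
    (fun a x => by rw [Module.End.mem_eigenspace_iff]; rfl)
  have e1 : ζ * ζ ^ i.val = ζ ^ (i + 1).val := by
    rw [← pow_succ', zmod_pow_eq hm hζ]
    simp
  have e2 : (ζ ^ (i + 1).val)⁻¹ = ζ ^ (-i - 1).val := by
    refine inv_eq_of_mul_eq_one_right ?_
    rw [← pow_add]
    have := (zmod_pow_eq hm hζ (0 : ZMod m) ((i + 1).val + (-i - 1).val)).2 (by simp)
    simpa using this
  rw [e1, e2] at hrel
  unfold gradePiece
  omega

end killing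

end DimPiece

theorem dim_piece_succ_sub
    (m : ℕ) (hm : 1 ≤ m) (ζ : k) (hζ : IsPrimitiveRoot ζ m)
    (θ : g ≃ₗ[k] g) (hθb : ∀ x y : g, θ ⁅x, y⁆ = ⁅θ x, θ y⁆) (hθm : θ ^ m = 1)
    (hθinner : θ ∈ IntG k g)
    (e h f : g)
    (hhe : ⁅h, e⁆ = (2 : k) • e) (hhf : ⁅h, f⁆ = -((2 : k) • f)) (hef : ⁅e, f⁆ = h)
    (hθe : θ e = ζ • e) (hθh : θ h = h) (hθf : θ f = ζ⁻¹ • f)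
    (hen : IsNilpotent (LieAlgebra.ad k g e))
    (her : Module.finrank k (zc k g e) = LieAlgebra.rank k g)
    (i : ZMod m) :
    (Module.finrank k (gradePiece k g ζ θ (i + 1)) : ℤ)
        - Module.finrank k (gradePiece k g ζ θ i)
      = (kNum k g m e h (-i - 1) : ℤ) - kNum k g m e h i := by
  exact DimPiece.main_killing hm hζ θ hθb hθm hθinner e h f hhe hhf hef hθe hθh hθf hen her i
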